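/- Suppose there is ε ∈ (0, 1] with ν^i_a(x) ≥ ε for all i ∈ {1,…,m}, a ∈ {1,…,K}, x ∈ X. Then the Hamiltonian H : ℝ^m → ℝ defined by H(p) = max over a ∈ {1,…,K} of inf over q ∈ Δ_X of Σ_{i=1}^m p_i·D(q‖ν^i_a) is Lipschitz continuous with respect to the Euclidean norm on ℝ^m, with Lipschitz constant √m·log(1/ε). -/

import Mathlib

/-- A probability mass function on a finite type. -/
def IsPMF {X : Type*} [Fintype X] (q : X → ℝ) : Prop :=
  (∀ x, 0 ≤ q x) ∧ ∑ x, q x = 1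

/-- KL divergence between pmfs on a finite type (convention `0 · log 0 = 0`). -/
noncomputable def KL {X : Type*} [Fintype X] (q p : X → ℝ) : ℝ :=
  ∑ x, q x * Real.log (q x / p x)

/-- The Hamiltonian `H(p) = max_a inf_{q ∈ Δ_X} Σ_i p_i D(q ‖ ν^i_a)`. -/
noncomputable def Ham {X : Type*} [Fintype X] {K m : ℕ} (ν : Fin m → Fin K → X → ℝ)
    (p : Fin m → ℝ) : ℝ :=
  ⨆ a : Fin K, ⨅ q : {q : X → ℝ // IsPMF q}, ∑ i, p i * KL q.1 (ν i a)

/-- The Gibbs inequality for probability mass functions on a finite type. -/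
lemma KL_nonneg {X : Type*} [Fintype X] {q p : X → ℝ} (hq : IsPMF q) (hp : IsPMF p)
    (hpos : ∀ x, 0 < p x) : 0 ≤ KL q p := by
  have hsum : ∑ x, (q x - p x) = 0 := by
    rw [Finset.sum_sub_distrib, hq.2, hp.2, sub_self]
  rw [← hsum]
  refine Finset.sum_le_sum fun x _ => ?_
  rcases (hq.1 x).eq_or_lt with h | h
  · simp [← h, (hpos x).le]
  · calc q x - p x = q x * (1 - (q x / p x)⁻¹) := by
          have := (hpos x).ne'
          field_simp
      _ ≤ q x * Real.log (q x / p x) :=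
          mul_le_mul_of_nonneg_left (Real.one_sub_inv_le_log_of_pos (div_pos h (hpos x))) h.le

/-- A lower bound on the reference mass function bounds the divergence from above. -/
lemma KL_le_log {X : Type*} [Fintype X] {q p : X → ℝ} {ε : ℝ} (hq : IsPMF q) (hε : 0 < ε)
    (hlb : ∀ x, ε ≤ p x) : KL q p ≤ Real.log (1 / ε) := by
  calc KL q p ≤ ∑ x, q x * Real.log (1 / ε) := by
        refine Finset.sum_le_sum fun x _ => ?_
        rcases (hq.1 x).eq_or_lt with h | h
        · simp [← h]
        · have hle : q x ≤ 1 := by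
            rw [← hq.2]
            exact Finset.single_le_sum (fun y _ => hq.1 y) (Finset.mem_univ x)
          exact mul_le_mul_of_nonneg_left (Real.log_le_log (div_pos h (hε.trans_le (hlb x)))
            (div_le_div₀ zero_le_one hle hε (hlb x))) h.le
    _ = Real.log (1 / ε) := by rw [← Finset.sum_mul, hq.2, one_mul]

/-- The `ℓ¹` norm is at most `√m` times the Euclidean norm. -/
lemma sum_abs_le_sqrt_mul_sqrt {m : ℕ} (v : Fin m → ℝ) :
    ∑ i, |v i| ≤ Real.sqrt m * Real.sqrt (∑ i, v i ^ 2) := by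
  rw [← Real.sqrt_mul (Nat.cast_nonneg m)]
  refine Real.le_sqrt_of_sq_le ?_
  simpa using sq_sum_le_card_mul_sum_sq (s := Finset.univ) (f := fun i => |v i|)

/-- One-sided Lipschitz bound for the Hamiltonian in terms of a uniform bound on the
divergences. -/
lemma Ham_le_add {X : Type*} [Fintype X] {K m : ℕ} [Nonempty (Fin K)]
    [Nonempty {q : X → ℝ // IsPMF q}] {ν : Fin m → Fin K → X → ℝ} {L : ℝ}
    (hL : ∀ i a q, IsPMF q → |KL q (ν i a)| ≤ L) (p p' : Fin m → ℝ) :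
    Ham ν p ≤ Ham ν p' + L * ∑ i, |p i - p' i| := by
  have habs : ∀ (v : Fin m → ℝ) a (q : {q : X → ℝ // IsPMF q}),
      |∑ i, v i * KL q.1 (ν i a)| ≤ L * ∑ i, |v i| := fun v a q => by
    rw [Finset.mul_sum]
    refine (Finset.abs_sum_le_sum_abs _ _).trans (Finset.sum_le_sum fun i _ => ?_)
    rw [abs_mul, mul_comm]
    exact mul_le_mul_of_nonneg_right (hL i a q q.2) (abs_nonneg _)
  refine ciSup_le fun a => ?_
  refine le_trans ?_ (add_le_add_left (le_ciSup (Set.finite_range _).bddAbove a) _)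
  rw [← sub_le_iff_le_add]
  refine le_ciInf fun q => ?_
  rw [sub_le_iff_le_add]
  have hbdd : BddBelow (Set.range fun q : {q : X → ℝ // IsPMF q} =>
      ∑ i, p i * KL q.1 (ν i a)) :=
    ⟨-(L * ∑ i, |p i|), by rintro _ ⟨q, rfl⟩; exact (abs_le.1 (habs p a q)).1⟩
  refine (ciInf_le hbdd q).trans ?_
  have hdiff := (abs_le.1 (habs (fun i => p i - p' i) a q)).2
  simp only [sub_mul, Finset.sum_sub_distrib] at hdiff
  linarith

/-- **Lipschitzness of the Hamiltonian (Lemma 1 of the paper).**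
If `ν^i_a(x) ≥ ε` for all `i, a, x`, then `H` is Lipschitz wrt the Euclidean norm
with constant `√m · log(1/ε)`. -/
theorem stmt_4 {X : Type*} [Fintype X] [Nonempty X] (K m : ℕ) (hK : 1 ≤ K) (hm : 2 ≤ m)
    (ν : Fin m → Fin K → X → ℝ) (hν : ∀ i a, IsPMF (ν i a))
    (hfull : ∀ i a x, 0 < ν i a x)
    (ε : ℝ) (hε0 : 0 < ε) (hε1 : ε ≤ 1) (hlb : ∀ i a x, ε ≤ ν i a x) :
    ∀ p p' : Fin m → ℝ,
      |Ham ν p - Ham ν p'| ≤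
        Real.sqrt m * Real.log (1 / ε) * Real.sqrt (∑ i, (p i - p' i) ^ 2) := by
  intro p p'
  have : Nonempty (Fin K) := ⟨⟨0, hK⟩⟩
  have : Nonempty {q : X → ℝ // IsPMF q} := ⟨⟨_, hν ⟨0, by omega⟩ ⟨0, hK⟩⟩⟩
  have hL : ∀ i a q, IsPMF q → |KL q (ν i a)| ≤ Real.log (1 / ε) := fun i a q hq => by
    rw [abs_of_nonneg (KL_nonneg hq (hν i a) (hfull i a))]
    exact KL_le_log hq hε0 (hlb i a)
  have hlog : 0 ≤ Real.log (1 / ε) := Real.log_nonneg (one_le_one_div hε0 hε1)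
  have hbound := mul_le_mul_of_nonneg_left
    (sum_abs_le_sqrt_mul_sqrt fun i => p i - p' i) hlog
  have hle := Ham_le_add hL p p'
  have hge := Ham_le_add hL p' p
  simp only [abs_sub_comm (p' _)] at hge
  rw [abs_sub_le_iff]
  constructor <;> linarith
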